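/- arXiv:1503.03849 — 3 statements merged into one kernel-verified Lean document; each statement's English description precedes it below -/
import Mathlib

section
/- Let A be an associative unital algebra over ℂ containing elements y₁, y₂, y₃, y₄, p₁, p₂, p₃, p₄ satisfying [yⱼ, pₖ] = i·δ_{jk}·1 and [yⱼ, yₖ] = [pⱼ, pₖ] = 0 for all j,k, let ω ∈ ℝ, and set H = p₁y₂ − ω²p₂y₁ + ω²p₃y₄ − p₄y₃. Then for every natural number m: [H, y₁]_{2m} = ω^{2m}·y₁, [H, y₂]_{2m} = ω^{2m}·y₂, [H, y₃]_{2m} = ω^{2m}·y₃, [H, y₄]_{2m} = ω^{2m}·y₄, and [H, y₁]_{2m+1} = −i·ω^{2m}·y₂, [H, y₂]_{2m+1} = i·ω^{2m+2}·y₁, [H, y₃]_{2m+1} = −i·ω^{2m+2}·y₄, [H, y₄]_{2m+1} = i·ω^{2m}·y₃. -/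
/-- The multiple commutator `[H, B]_k`, defined by `[H,B]₀ = B` and
`[H,B]_{k+1} = [H, [H,B]_k]` with `[A,B] = AB - BA`. -/
def adPow {A : Type*} [Ring A] (H B : A) : ℕ → A
  | 0 => B
  | k + 1 => H * adPow H B k - adPow H B k * H

/-- If `[H, u] = a v` and `[H, v] = b u`, the multiple commutators of `u` alternate between
multiples of `u` and multiples of `v`. -/
theorem adPow_two_mul_and_succ {A : Type*} [Ring A] [Algebra ℂ A] {H u v : A} {a b : ℂ}
    (hu : H * u - u * H = a • v) (hv : H * v - v * H = b • u) (m : ℕ) :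
    adPow H u (2 * m) = (a * b) ^ m • u ∧ adPow H u (2 * m + 1) = (a * (a * b) ^ m) • v := by
  have odd_of_even : ∀ m, adPow H u (2 * m) = (a * b) ^ m • u →
      adPow H u (2 * m + 1) = (a * (a * b) ^ m) • v := by
    intro m h
    rw [adPow, h, mul_smul_comm, smul_mul_assoc, ← smul_sub, hu, smul_smul, mul_comm a (_ ^ m)]
  have even : ∀ m, adPow H u (2 * m) = (a * b) ^ m • u := by
    intro m
    induction m with
    | zero => simp [adPow]
    | succ m ih =>
      rw [show 2 * (m + 1) = 2 * m + 1 + 1 by ring, adPow, odd_of_even m ih, mul_smul_comm,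
        smul_mul_assoc, ← smul_sub, hv, smul_smul]
      congr 1
      ring
  exact ⟨even m, odd_of_even m (even m)⟩

/-- The commutator of `p z` with `u`, when `z` commutes with `u` and `[u, p] = c`. -/
theorem mul_commutator_of_commute {A : Type*} [Ring A] [Algebra ℂ A] {p z u : A} {c : ℂ}
    (hp : u * p - p * u = c • (1 : A)) (hz : z * u = u * z) :
    p * z * u - u * (p * z) = -(c • z) := by
  have h : p * z * u - u * (p * z) = -((u * p - p * u) * z) := by
    rw [mul_assoc, hz]
    noncomm_ring
  rw [h, hp, smul_one_mul]

theorem hamiltonian_multiple_commutators (A : Type*) [Ring A] [Algebra ℂ A]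
    (y p : Fin 4 → A) (ω : ℝ)
    (hyp : ∀ j k, y j * p k - p k * y j = (if j = k then Complex.I else 0) • (1 : A))
    (hyy : ∀ j k, y j * y k = y k * y j)
    (hpp : ∀ j k, p j * p k = p k * p j)
    (H : A)
    (hH : H = p 0 * y 1 - ((ω : ℂ) ^ 2) • (p 1 * y 0)
        + ((ω : ℂ) ^ 2) • (p 2 * y 3) - p 3 * y 2) :
    ∀ m : ℕ,
      adPow H (y 0) (2 * m) = ((ω : ℂ) ^ (2 * m)) • y 0 ∧
      adPow H (y 1) (2 * m) = ((ω : ℂ) ^ (2 * m)) • y 1 ∧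
      adPow H (y 2) (2 * m) = ((ω : ℂ) ^ (2 * m)) • y 2 ∧
      adPow H (y 3) (2 * m) = ((ω : ℂ) ^ (2 * m)) • y 3 ∧
      adPow H (y 0) (2 * m + 1) = ((-Complex.I) * (ω : ℂ) ^ (2 * m)) • y 1 ∧
      adPow H (y 1) (2 * m + 1) = (Complex.I * (ω : ℂ) ^ (2 * m + 2)) • y 0 ∧
      adPow H (y 2) (2 * m + 1) = ((-Complex.I) * (ω : ℂ) ^ (2 * m + 2)) • y 3 ∧
      adPow H (y 3) (2 * m + 1) = (Complex.I * (ω : ℂ) ^ (2 * m)) • y 2 := by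
  have hc : ∀ j k l, p k * y l * y j - y j * (p k * y l) =
      -((if j = k then Complex.I else 0) • y l) :=
    fun j k l => mul_commutator_of_commute (hyp j k) (hyy l j)
  have hHy : ∀ j, H * y j - y j * H =
      (p 0 * y 1 * y j - y j * (p 0 * y 1))
        - ((ω : ℂ) ^ 2) • (p 1 * y 0 * y j - y j * (p 1 * y 0))
        + ((ω : ℂ) ^ 2) • (p 2 * y 3 * y j - y j * (p 2 * y 3))
        - (p 3 * y 2 * y j - y j * (p 3 * y 2)) := by
    intro j
    rw [hH]
    simp only [sub_mul, add_mul, mul_sub, mul_add, smul_mul_assoc, mul_smul_comm, smul_sub]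
    abel
  have h0 : H * y 0 - y 0 * H = (-Complex.I) • y 1 := by
    rw [hHy]
    simp [hc]
  have h1 : H * y 1 - y 1 * H = (Complex.I * (ω : ℂ) ^ 2) • y 0 := by
    rw [hHy]
    simp [hc, smul_smul, mul_comm]
  have h2 : H * y 2 - y 2 * H = (-Complex.I * (ω : ℂ) ^ 2) • y 3 := by
    rw [hHy]
    simp [hc, smul_smul, mul_comm]
  have h3 : H * y 3 - y 3 * H = Complex.I • y 2 := by
    rw [hHy]
    simp [hc]
  have hI : -Complex.I * (Complex.I * (ω : ℂ) ^ 2) = (ω : ℂ) ^ 2 := by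
    linear_combination (-(ω : ℂ) ^ 2) * Complex.I_mul_I
  have hI₁ : Complex.I * (ω : ℂ) ^ 2 * -Complex.I = (ω : ℂ) ^ 2 := by
    rw [mul_comm, hI]
  have hI₂ : -Complex.I * (ω : ℂ) ^ 2 * Complex.I = (ω : ℂ) ^ 2 := by
    linear_combination hI
  have hI₃ : Complex.I * (-Complex.I * (ω : ℂ) ^ 2) = (ω : ℂ) ^ 2 := by
    linear_combination hI
  intro m
  obtain ⟨e0, o0⟩ := adPow_two_mul_and_succ h0 h1 m
  obtain ⟨e1, o1⟩ := adPow_two_mul_and_succ h1 h0 m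
  obtain ⟨e2, o2⟩ := adPow_two_mul_and_succ h2 h3 m
  obtain ⟨e3, o3⟩ := adPow_two_mul_and_succ h3 h2 m
  rw [hI, ← pow_mul] at e0 o0
  rw [hI₁, ← pow_mul] at e1 o1
  rw [hI₂, ← pow_mul] at e2 o2
  rw [hI₃, ← pow_mul] at e3 o3
  rw [mul_assoc, ← pow_add, add_comm 2] at o1 o2
  exact ⟨e0, e1, e2, e3, o0, o1, o2, o3⟩
end

section
/- Let β ∈ ℝ, let u : ℝ → ℝ be continuous, and let x₁, x₂ : ℝ → ℝ be differentiable functions satisfying x₁′(t) = x₂(t) and x₂′(t) = −β·x₂(t) − sin(x₁(t)) + u(t) for all t. Then for every t ∈ ℝ, x₂(t) + β·x₁(t) + ∫₀ᵗ (sin(x₁(τ)) − u(τ)) dτ = x₂(0) + β·x₁(0). -/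
theorem pendulum_integral_of_motion (β : ℝ) (u : ℝ → ℝ) (hu : Continuous u)
    (x₁ x₂ : ℝ → ℝ)
    (h1 : ∀ t : ℝ, HasDerivAt x₁ (x₂ t) t)
    (h2 : ∀ t : ℝ, HasDerivAt x₂ (-β * x₂ t - Real.sin (x₁ t) + u t) t) :
    ∀ t : ℝ, x₂ t + β * x₁ t + ∫ τ in (0:ℝ)..t, (Real.sin (x₁ τ) - u τ) =
      x₂ 0 + β * x₁ 0 := by
  intro t
  have hx₁ : Continuous x₁ := continuous_iff_continuousAt.2 fun s => (h1 s).continuousAt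
  have hderiv : ∀ s ∈ Set.uIcc 0 t,
      HasDerivAt (fun s => -(x₂ s + β * x₁ s)) (Real.sin (x₁ s) - u s) s := fun s _ =>
    ((h2 s).fun_add ((h1 s).const_mul β)).fun_neg.congr_deriv (by ring)
  rw [intervalIntegral.integral_eq_sub_of_hasDerivAt hderiv
    (((Real.continuous_sin.comp hx₁).sub hu).intervalIntegrable 0 t)]
  ring
end

section
/- Let β, x₁⁰, x₂⁰, T ∈ ℝ and write D = −β·x₂⁰ − sin(x₁⁰) − 1. Define x̃₁(t) = x₁⁰ + t·x₂⁰ + (t²/2)·D and x̃₂(t) = x₂⁰ + t·D + (t²/2)·(−β·D − x₂⁰·cos(x₁⁰)). If x̃₁(T) = 0, x̃₂(T) = 0, and D·(sin(x₁⁰) + 1) − (x₂⁰)²·cos(x₁⁰) ≠ 0, then T = ( D·(x₂⁰ + β·x₁⁰) + x₁⁰·x₂⁰·cos(x₁⁰) ) / ( D·(sin(x₁⁰) + 1) − (x₂⁰)²·cos(x₁⁰) ). -/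
theorem pendulum_optimal_time_formula (β x₁0 x₂0 T : ℝ)
    (D : ℝ) (hD : D = -β * x₂0 - Real.sin x₁0 - 1)
    (x₁ x₂ : ℝ → ℝ)
    (hx₁ : x₁ = fun t => x₁0 + t * x₂0 + t ^ 2 / 2 * D)
    (hx₂ : x₂ = fun t => x₂0 + t * D + t ^ 2 / 2 * (-β * D - x₂0 * Real.cos x₁0))
    (h1 : x₁ T = 0) (h2 : x₂ T = 0)
    (h3 : D * (Real.sin x₁0 + 1) - x₂0 ^ 2 * Real.cos x₁0 ≠ 0) :
    T = (D * (x₂0 + β * x₁0) + x₁0 * x₂0 * Real.cos x₁0) /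
      (D * (Real.sin x₁0 + 1) - x₂0 ^ 2 * Real.cos x₁0) := by
  subst hx₁ hx₂
  rw [eq_div_iff h3]
  linear_combination
    (-β * D - x₂0 * Real.cos x₁0) * h1 - D * h2 + T * D * hD
end
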